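/- Let $m,n$ be positive integers with $m$ even, $n$ odd and $m\ge 2n$. Set $K_{m,n}=\tfrac{n}{m-n}(\tfrac{m-n}{m})^{m/n}$, $K_{m,m-n}=\tfrac{m-n}{n}(\tfrac{n}{m})^{m/(m-n)}$ and $g(t)=\tfrac{2mt}{(m-n)|t|^{m/(m-n)}+mt-n}$. Let $\Lambda:[0,\tfrac{m}{m-n}]\to[-1,0]$ be a continuous strictly decreasing function with $\Lambda(0)=0$ such that $mK_{m,n}\Lambda(b)b^{m/n}-nb-m\Lambda(b)+(m-n)b|\Lambda(b)|^{m/(m-n)}=0$ for all $b\in[0,\tfrac{m}{m-n}]$, and set $\tau_0=\Lambda(\tfrac{m}{m-n})$. Define $\mathcal{A}^1=\{(b,t):b\in(0,\tfrac{m}{m-n}],\ \Lambda(b)\le t<0\}$, $\mathcal{B}^1=\{(b,t):b\in(0,\tfrac{m}{m-n}],\ \tau_0\le t\le\Lambda(b)\}\cup\{(b,t):t\in[-1,\tau_0],\ 0<b\le g(t)\}$, $\mathcal{A}=\mathcal{A}^1\cup(-\mathcal{A}^1)$ and $\mathcal{B}=\mathcal{B}^1\cup(-\mathcal{B}^1)$.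 Then for every $(a,b,c)\in\mathbb{R}^3$: $\vertiii{(a,b,c)}_{m,n}=\big|K_{m,n}a|\tfrac{b}{a}|^{m/n}-c\big|$ if $abc\neq 0$ and $(\tfrac{b}{a},\tfrac{nb}{mc})\in\mathcal{A}$; $\vertiii{(a,b,c)}_{m,n}=\big|K_{m,m-n}c|\tfrac{b}{c}|^{m/(m-n)}-a\big|$ if $abc\neq 0$ and $(\tfrac{b}{a},\tfrac{nb}{mc})\in\mathcal{B}$; $\vertiii{(a,b,c)}_{m,n}=\max\{|a|,|c|\}$ if $b=0$ and $ac\le 0$; and $\vertiii{(a,b,c)}_{m,n}=|a+c|+|b|$ otherwise. -/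

import Mathlib

open Set

/-- The homogeneous trinomial norm `⦀(a,b,c)⦀_{m,n}`:
the sup of `|a x^m + b x^{m-n} y^n + c y^m|` over the unit square. -/
noncomputable def homNorm (m n : ℕ) (a b c : ℝ) : ℝ :=
  sSup ((fun p : ℝ × ℝ => |a * p.1 ^ m + b * p.1 ^ (m - n) * p.2 ^ n + c * p.2 ^ m|) ''
    (Icc (-1 : ℝ) 1 ×ˢ Icc (-1 : ℝ) 1))

/-- The constant `K_{m,k} = k/(m-k) · ((m-k)/m)^{m/k}`; note that
`Kc m (m-n)` is the constant `K_{m,m-n} = (m-n)/n · (n/m)^{m/(m-n)}`. -/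
noncomputable def Kc (m k : ℕ) : ℝ :=
  (k : ℝ) / ((m : ℝ) - k) * (((m : ℝ) - k) / m) ^ ((m : ℝ) / k)

/-- The function `g(t) = 2mt/((m-n)|t|^{m/(m-n)} + mt - n)`. -/
noncomputable def gfun (m n : ℕ) (t : ℝ) : ℝ :=
  2 * m * t / (((m : ℝ) - n) * |t| ^ ((m : ℝ) / ((m : ℝ) - n)) + m * t - n)

/-- The region `𝒜¹ = {(b,t) : b ∈ (0, m/(m-n)], Λ(b) ≤ t < 0}`. -/
def Aone (m n : ℕ) (Λ : ℝ → ℝ) : Set (ℝ × ℝ) :=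
  {p | 0 < p.1 ∧ p.1 ≤ (m : ℝ) / ((m : ℝ) - n) ∧ Λ p.1 ≤ p.2 ∧ p.2 < 0}

/-- The region `ℬ¹`, where `τ₀ = Λ(m/(m-n))`. -/
noncomputable def Bone (m n : ℕ) (Λ : ℝ → ℝ) : Set (ℝ × ℝ) :=
  {p | 0 < p.1 ∧ p.1 ≤ (m : ℝ) / ((m : ℝ) - n) ∧
      Λ ((m : ℝ) / ((m : ℝ) - n)) ≤ p.2 ∧ p.2 ≤ Λ p.1}
  ∪ {p | -1 ≤ p.2 ∧ p.2 ≤ Λ ((m : ℝ) / ((m : ℝ) - n)) ∧ 0 < p.1 ∧ p.1 ≤ gfun m n p.2}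

/-- `𝒜 = 𝒜¹ ∪ (-𝒜¹)`. -/
def Afull (m n : ℕ) (Λ : ℝ → ℝ) : Set (ℝ × ℝ) :=
  Aone m n Λ ∪ {p | -p ∈ Aone m n Λ}

/-- `ℬ = ℬ¹ ∪ (-ℬ¹)`. -/
noncomputable def Bfull (m n : ℕ) (Λ : ℝ → ℝ) : Set (ℝ × ℝ) :=
  Bone m n Λ ∪ {p | -p ∈ Bone m n Λ}

section TrinomialLemmas

lemma exists_odd_pow_eq {k : ℕ} (hk : Odd k) {s : ℝ} (hs : |s| ≤ 1) :
    ∃ x : ℝ, |x| ≤ 1 ∧ x ^ k = s := by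
  have hk0 : k ≠ 0 := hk.pos.ne'
  have hpow : (|s| ^ ((k : ℝ)⁻¹)) ^ k = |s| := Real.rpow_inv_natCast_pow (abs_nonneg s) hk0
  have hle : |s| ^ ((k : ℝ)⁻¹) ≤ 1 := Real.rpow_le_one (abs_nonneg s) hs (by positivity)
  have hnn : 0 ≤ |s| ^ ((k : ℝ)⁻¹) := by positivity
  rcases le_total 0 s with h | h
  · exact ⟨|s| ^ ((k : ℝ)⁻¹), by rwa [abs_of_nonneg hnn], by rw [hpow, abs_of_nonneg h]⟩
  · refine ⟨-|s| ^ ((k : ℝ)⁻¹), by rwa [abs_neg, abs_of_nonneg hnn], ?_⟩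
    rw [hk.neg_pow, hpow, abs_of_nonpos h, neg_neg]

lemma abs_pow_rpow_div {m k : ℕ} (hm : Even m) (hk : k ≠ 0) (x : ℝ) :
    |x ^ k| ^ ((m : ℝ) / k) = x ^ m := by
  have hk' : (k : ℝ) ≠ 0 := by exact_mod_cast hk
  rw [abs_pow, ← Real.rpow_natCast, ← Real.rpow_mul (abs_nonneg x), mul_div_cancel₀ _ hk',
    Real.rpow_natCast, hm.pow_abs]

/-- The norm is computed on the two sides of the square where one variable equals `1`, after
substituting `s = x ^ (m - n)` and `t = y ^ n`. -/
lemma homNorm_eq_of_bounds {m n : ℕ} (hm : Even m) (hn : Odd n) (hnm : n < m) {a b c M : ℝ}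
    (hF : ∀ s : ℝ, |s| ≤ 1 → |a * |s| ^ ((m : ℝ) / ((m : ℝ) - n)) + b * s + c| ≤ M)
    (hG : ∀ t : ℝ, |t| ≤ 1 → |a + b * t + c * |t| ^ ((m : ℝ) / n)| ≤ M)
    (hM : (∃ s : ℝ, |s| ≤ 1 ∧ |a * |s| ^ ((m : ℝ) / ((m : ℝ) - n)) + b * s + c| = M) ∨
      ∃ t : ℝ, |t| ≤ 1 ∧ |a + b * t + c * |t| ^ ((m : ℝ) / n)| = M) :
    homNorm m n a b c = M := by
  have hmn : Odd (m - n) := Nat.Even.sub_odd hnm.le hm hn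
  have hcast : (m : ℝ) - n = ((m - n : ℕ) : ℝ) := by rw [Nat.cast_sub hnm.le]
  rw [hcast] at hF hM
  have hM0 : 0 ≤ M := (abs_nonneg _).trans (hF 0 (by simp))
  have hsplit (x : ℝ) : x ^ m = x ^ (m - n) * x ^ n := by
    rw [← pow_add, Nat.sub_add_cancel hnm.le]
  have hone (x : ℝ) (hx : |x| ≤ 1) : |x ^ m| ≤ 1 := by
    rw [abs_pow]; exact pow_le_one₀ (abs_nonneg _) hx
  refine IsLUB.csSup_eq (s := _) ⟨?_, ?_⟩ ⟨_, ⟨(0, 0), by simp, rfl⟩⟩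
  · rintro _ ⟨⟨x, y⟩, ⟨hx, hy⟩, rfl⟩
    have hx' : |x| ≤ 1 := abs_le.2 hx
    have hy' : |y| ≤ 1 := abs_le.2 hy
    dsimp only
    have key (z w : ℝ) (hz : |z| ≤ 1) (hw : |w| ≤ M) : |z ^ m * w| ≤ M := by
      rw [abs_mul]
      calc |z ^ m| * |w| ≤ 1 * M := mul_le_mul (hone z hz) hw (abs_nonneg _) zero_le_one
        _ = M := one_mul M
    have hratio (u v : ℝ) (h : |u| ≤ |v|) (k : ℕ) : |(u / v) ^ k| ≤ 1 := by
      rw [abs_pow, abs_div]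
      exact pow_le_one₀ (by positivity) (div_le_one_of_le₀ h (abs_nonneg _))
    rcases le_total |x| |y| with h | h
    · rcases eq_or_ne y 0 with rfl | hy0
      · have hx0 : x = 0 := by simpa using h
        subst hx0
        simpa [hn.pos.ne', (hn.pos.trans hnm).ne'] using hM0
      · have := key y _ hy' (hF ((x / y) ^ (m - n)) (hratio x y h _))
        rw [abs_pow_rpow_div hm hmn.pos.ne'] at this
        refine (congrArg abs ?_).trans_le this
        rw [mul_add, mul_add]
        congr 1
        · congr 1
          · rw [div_pow]; field_simp
          · rw [hsplit y, div_pow]; field_simp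
        · ring
    · rcases eq_or_ne x 0 with rfl | hx0
      · have hy0 : y = 0 := by simpa using h
        subst hy0
        simpa [hn.pos.ne', (hn.pos.trans hnm).ne'] using hM0
      · have := key x _ hx' (hG ((y / x) ^ n) (hratio y x h _))
        rw [abs_pow_rpow_div hm hn.pos.ne'] at this
        refine (congrArg abs ?_).trans_le this
        rw [mul_add, mul_add]
        congr 1
        · congr 1
          · ring
          · rw [hsplit x, div_pow]; field_simp
        · rw [div_pow]; field_simp
  · intro B hB
    rcases hM with ⟨s, hs, rfl⟩ | ⟨t, ht, rfl⟩
    · obtain ⟨x, hx, rfl⟩ := exists_odd_pow_eq hmn hs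
      refine hB ⟨(x, 1), ⟨abs_le.1 hx, by simp⟩, ?_⟩
      simp only [abs_pow_rpow_div hm hmn.pos.ne', one_pow, mul_one]
    · obtain ⟨y, hy, rfl⟩ := exists_odd_pow_eq hn ht
      refine hB ⟨(1, y), ⟨by simp, abs_le.1 hy⟩, ?_⟩
      simp only [abs_pow_rpow_div hm hn.pos.ne', one_pow, mul_one]

lemma homNorm_neg (m n : ℕ) (a b c : ℝ) :
    homNorm m n (-a) (-b) (-c) = homNorm m n a b c := by
  unfold homNorm
  congr 1
  refine image_congr fun p _ => ?_
  rw [← abs_neg]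
  congr 1
  ring

lemma homNorm_neg_middle {m n : ℕ} (hm : Even m) (hn : Odd n) (a b c : ℝ) :
    homNorm m n a (-b) c = homNorm m n a b c := by
  have hsub (a b : ℝ) : (fun p : ℝ × ℝ =>
        |a * p.1 ^ m + (-b) * p.1 ^ (m - n) * p.2 ^ n + c * p.2 ^ m|) ''
          (Icc (-1 : ℝ) 1 ×ˢ Icc (-1 : ℝ) 1) ⊆
      (fun p : ℝ × ℝ => |a * p.1 ^ m + b * p.1 ^ (m - n) * p.2 ^ n + c * p.2 ^ m|) ''
          (Icc (-1 : ℝ) 1 ×ˢ Icc (-1 : ℝ) 1) := by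
    rintro _ ⟨⟨x, y⟩, ⟨hx, hy⟩, rfl⟩
    refine ⟨(x, -y), ⟨hx, ?_⟩, ?_⟩
    · simp only [mem_Icc] at hy ⊢
      constructor <;> linarith
    · dsimp only
      rw [hn.neg_pow, hm.neg_pow]
      ring_nf
  unfold homNorm
  congr 1
  refine (hsub a b).antisymm ?_
  simpa using hsub a (-b)

variable {p q : ℝ} {a b d : ℝ}

/-- Young's inequality scaled to the binomial `a s ^ p - b s`. -/
lemma mul_le_rpow_add_conj (hpq : p.HolderConjugate q) (ha : 0 < a) (hb : 0 < b) {s : ℝ}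
    (hs : 0 ≤ s) : b * s ≤ a * s ^ p + (p - 1) * a * (b / (p * a)) ^ q := by
  have hp := hpq.pos
  have h := Real.young_inequality_of_nonneg hs (b := b / (p * a)) (by positivity) hpq
  have h2 := mul_le_mul_of_nonneg_left h (mul_pos hp ha).le
  have h3 : p * a * (s * (b / (p * a))) = b * s := by field_simp
  have h4 : p / q = p - 1 := hpq.div_conj_eq_sub_one
  have h5 : p * a * (s ^ p / p + (b / (p * a)) ^ q / q) =
      a * s ^ p + p / q * a * (b / (p * a)) ^ q := by field_simp
  rwa [h3, h5, h4] at h2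

lemma abs_trinomial_le (hpq : p.HolderConjugate q) (ha : 0 < a) (hb : 0 < b) {M : ℝ}
    (h1 : a - d + b ≤ M) (h2 : d + (p - 1) * a * (b / (p * a)) ^ q ≤ M) {s : ℝ} (hs : |s| ≤ 1) :
    |a * |s| ^ p + b * s - d| ≤ M := by
  have hy := mul_le_rpow_add_conj hpq ha hb (abs_nonneg s)
  have hs1 : |s| ^ p ≤ 1 := Real.rpow_le_one (abs_nonneg s) hs hpq.nonneg
  have e1 : b * s ≤ b := by nlinarith [le_abs_self s]
  have e2 : -(b * |s|) ≤ b * s := by nlinarith [neg_abs_le s]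
  rw [abs_le]
  constructor <;> nlinarith

lemma abs_trinomial_le_of_lt (hp : 1 < p) (ha : 0 < a) (hb : p * a < b) {M : ℝ}
    (h1 : a - d + b ≤ M) (h2 : d - a + b ≤ M) {s : ℝ} (hs : |s| ≤ 1) :
    |a * |s| ^ p + b * s - d| ≤ M := by
  have hB := one_add_mul_self_le_rpow_one_add (s := |s| - 1) (by linarith [abs_nonneg s]) hp.le
  rw [add_sub_cancel] at hB
  have hb0 : 0 < b := lt_trans (by positivity) hb
  have hs1 : |s| ^ p ≤ 1 := Real.rpow_le_one (abs_nonneg s) hs (by linarith)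
  have e1 : b * s ≤ b := by nlinarith [le_abs_self s]
  have e2 : -(b * |s|) ≤ b * s := by nlinarith [neg_abs_le s]
  have e3 := mul_le_mul_of_nonneg_left hB ha.le
  have e4 : 0 ≤ (b - p * a) * (1 - |s|) := mul_nonneg (by linarith) (by linarith)
  rw [abs_le]
  constructor <;> nlinarith

lemma exists_abs_trinomial_eq (hpq : p.HolderConjugate q) (ha : 0 < a) (hb : 0 < b)
    (hd : 0 < d) (hab : b ≤ p * a) :
    ∃ s : ℝ, |s| ≤ 1 ∧ |a * |s| ^ p + b * s - d| = d + (p - 1) * a * (b / (p * a)) ^ q := by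
  have hp := hpq.pos
  have hp1 := hpq.lt
  have hu : 0 < b / (p * a) := by positivity
  have hu1 : b / (p * a) ≤ 1 := (div_le_one (by positivity)).2 hab
  have hb' : b = p * a * (b / (p * a)) := by field_simp
  set u := b / (p * a) with hu_def
  have habs : |(-u ^ (q - 1))| = u ^ (q - 1) := by
    rw [abs_neg, abs_of_pos (Real.rpow_pos_of_pos hu _)]
  refine ⟨-u ^ (q - 1), ?_, ?_⟩
  · rw [habs]
    exact Real.rpow_le_one hu.le hu1 (by linarith [hpq.symm.lt])
  · have e1 : (u ^ (q - 1)) ^ p = u ^ q := by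
      rw [← Real.rpow_mul hu.le]
      congr 1
      have := hpq.mul_eq_add
      linarith
    have e2 : u * u ^ (q - 1) = u ^ q := by
      rw [Real.rpow_sub_one hu.ne']; field_simp
    rw [habs, e1]
    have e3 : a * u ^ q + b * -u ^ (q - 1) - d = -(d + (p - 1) * a * u ^ q) := by
      have : b * u ^ (q - 1) = p * a * u ^ q := by rw [← e2, ← mul_assoc, ← hb']
      linear_combination -this
    rw [e3, abs_neg, abs_of_pos]
    have : 0 < u ^ q := Real.rpow_pos_of_pos hu _
    have : 0 < p - 1 := by linarith
    positivity

end TrinomialLemmas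

section PositiveCoefficients

variable {m n : ℕ} {a b d : ℝ}

lemma holderConjugate_degree_div (hn : 0 < n) (hnm : n < m) :
    ((m : ℝ) / ((m : ℝ) - n)).HolderConjugate ((m : ℝ) / n) := by
  have hn' : (0 : ℝ) < n := by exact_mod_cast hn
  have hnm' : (n : ℝ) < m := by exact_mod_cast hnm
  rw [Real.holderConjugate_iff]
  constructor
  · rw [one_lt_div (by linarith)]; linarith
  · rw [inv_div, inv_div, ← add_div, sub_add_cancel, div_self (by linarith)]

lemma homNorm_eq_left_critical (hm : Even m) (hn : Odd n) (hnm : n < m) (ha : 0 < a) (hb : 0 < b)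
    (hd : 0 < d) {p q : ℝ} (hp : p = (m : ℝ) / ((m : ℝ) - n)) (hq : q = (m : ℝ) / n)
    (hab : b ≤ p * a)
    (hcmp : a + (q - 1) * d * (b / (q * d)) ^ p ≤ d + (p - 1) * a * (b / (p * a)) ^ q) :
    homNorm m n a b (-d) = d + (p - 1) * a * (b / (p * a)) ^ q := by
  have hpq : p.HolderConjugate q := hp ▸ hq ▸ holderConjugate_degree_div hn.pos hnm
  have y1 := mul_le_rpow_add_conj hpq ha hb zero_le_one
  have y2 := mul_le_rpow_add_conj hpq.symm hd hb zero_le_one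
  rw [Real.one_rpow] at y1 y2
  refine homNorm_eq_of_bounds hm hn hnm ?_ ?_ (Or.inl ?_)
  · rw [← hp]
    exact fun s hs => abs_trinomial_le hpq ha hb (by linarith) le_rfl hs
  · rw [← hq]
    intro t ht
    have := abs_trinomial_le (d := a) hpq.symm hd hb (by linarith) hcmp (s := -t) (by rwa [abs_neg])
    rw [abs_neg, ← abs_neg] at this
    convert this using 2
    ring
  · rw [← hp]
    exact exists_abs_trinomial_eq hpq ha hb hd hab

lemma homNorm_eq_right_critical (hm : Even m) (hn : Odd n) (hnm : n < m) (ha : 0 < a) (hb : 0 < b)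
    (hd : 0 < d) {p q : ℝ} (hp : p = (m : ℝ) / ((m : ℝ) - n)) (hq : q = (m : ℝ) / n)
    (hdb : b ≤ q * d) (hend : d - a + b ≤ a + (q - 1) * d * (b / (q * d)) ^ p)
    (hcmp : d + (p - 1) * a * (b / (p * a)) ^ q ≤ a + (q - 1) * d * (b / (q * d)) ^ p ∨
      p * a < b) :
    homNorm m n a b (-d) = a + (q - 1) * d * (b / (q * d)) ^ p := by
  have hpq : p.HolderConjugate q := hp ▸ hq ▸ holderConjugate_degree_div hn.pos hnm
  have y2 := mul_le_rpow_add_conj hpq.symm hd hb zero_le_one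
  rw [Real.one_rpow] at y2
  refine homNorm_eq_of_bounds hm hn hnm ?_ ?_ (Or.inr ?_)
  · rw [← hp]
    intro s hs
    rcases hcmp with h | h
    · exact abs_trinomial_le hpq ha hb (by linarith) h hs
    · exact abs_trinomial_le_of_lt hpq.lt ha h (by linarith) hend hs
  · rw [← hq]
    intro t ht
    have := abs_trinomial_le (d := a) hpq.symm hd hb hend le_rfl (s := -t) (by rwa [abs_neg])
    rw [abs_neg, ← abs_neg] at this
    convert this using 2
    ring
  · rw [← hq]
    obtain ⟨s, hs, h⟩ := exists_abs_trinomial_eq hpq.symm hd hb ha hdb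
    refine ⟨-s, by rwa [abs_neg], ?_⟩
    rw [← h, abs_neg, ← abs_neg]
    congr 1
    ring

lemma homNorm_eq_corner (hm : Even m) (hn : Odd n) (hnm : n < m) (ha : 0 < a) (hb : 0 < b)
    (hd : 0 < d) {p q : ℝ} (hp : p = (m : ℝ) / ((m : ℝ) - n)) (hq : q = (m : ℝ) / n)
    (hleft : d + (p - 1) * a * (b / (p * a)) ^ q ≤ |a - d| + b ∨ p * a < b)
    (hright : a + (q - 1) * d * (b / (q * d)) ^ p ≤ |a - d| + b ∨ q * d < b) :
    homNorm m n a b (-d) = |a - d| + b := by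
  have hpq : p.HolderConjugate q := hp ▸ hq ▸ holderConjugate_degree_div hn.pos hnm
  have h1 := le_abs_self (a - d)
  have h2 := neg_abs_le (a - d)
  refine homNorm_eq_of_bounds hm hn hnm ?_ ?_ (Or.inl ?_)
  · rw [← hp]
    intro s hs
    rcases hleft with h | h
    · exact abs_trinomial_le hpq ha hb (by linarith) h hs
    · exact abs_trinomial_le_of_lt hpq.lt ha h (by linarith) (by linarith) hs
  · rw [← hq]
    intro t ht
    have : |d * |(-t)| ^ q + b * (-t) - a| ≤ |a - d| + b := by
      have ht' : |(-t)| ≤ 1 := by rwa [abs_neg]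
      rcases hright with h | h
      · exact abs_trinomial_le hpq.symm hd hb (by linarith) h ht'
      · exact abs_trinomial_le_of_lt hpq.symm.lt hd h (by linarith) (by linarith) ht'
    rw [abs_neg, ← abs_neg] at this
    convert this using 2
    ring
  · rcases le_total d a with h | h
    · refine ⟨1, by simp, ?_⟩
      rw [abs_one, Real.one_rpow, abs_of_nonneg (by linarith : 0 ≤ a - d), abs_of_nonneg] <;>
        linarith
    · refine ⟨-1, by simp, ?_⟩
      rw [abs_neg, abs_one, Real.one_rpow, abs_of_nonpos (by linarith : a - d ≤ 0),
        abs_of_nonpos] <;> linarith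

end PositiveCoefficients

section ImplicitFunction

/-- The left-hand side of the equation defining `Λ`, at `t = -σ`. -/
noncomputable def implicitEq (m n : ℕ) (β σ : ℝ) : ℝ :=
  m * σ + ((m : ℝ) - n) * β * σ ^ ((m : ℝ) / ((m : ℝ) - n)) -
    m * Kc m n * σ * β ^ ((m : ℝ) / n) - n * β

variable {m n : ℕ}

lemma mul_implicitEq_le (hnm : n < m) {β σ τ : ℝ} (hβ : 0 ≤ β) (hσ : 0 < σ) (hστ : σ ≤ τ) :
    τ * implicitEq m n β σ ≤ σ * implicitEq m n β τ := by
  have hnm' : (n : ℝ) < m := by exact_mod_cast hnm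
  have hn0 : (0 : ℝ) ≤ n := n.cast_nonneg
  have hτ : 0 < τ := hσ.trans_le hστ
  have hp : 1 ≤ (m : ℝ) / ((m : ℝ) - n) := by
    rw [one_le_div (by linarith)]; linarith
  unfold implicitEq
  set p := (m : ℝ) / ((m : ℝ) - n)
  have h1 : σ ^ (p - 1) ≤ τ ^ (p - 1) := Real.rpow_le_rpow hσ.le hστ (by linarith)
  have h2 : τ * σ ^ p ≤ σ * τ ^ p := by
    have e1 : σ ^ p = σ * σ ^ (p - 1) := by rw [Real.rpow_sub_one hσ.ne']; field_simp
    have e2 : τ ^ p = τ * τ ^ (p - 1) := by rw [Real.rpow_sub_one hτ.ne']; field_simp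
    rw [e1, e2]
    have := mul_le_mul_of_nonneg_left h1 (mul_pos hσ hτ).le
    linarith
  have h3 : 0 ≤ ((m : ℝ) - n) * β * (σ * τ ^ p - τ * σ ^ p) :=
    mul_nonneg (mul_nonneg (by linarith) hβ) (by linarith)
  have h4 : 0 ≤ n * β * (τ - σ) := mul_nonneg (mul_nonneg hn0 hβ) (by linarith)
  nlinarith

lemma implicitEq_nonpos (hnm : n < m) {β σ τ : ℝ} (hβ : 0 ≤ β) (hσ : 0 < σ) (hστ : σ ≤ τ)
    (h : implicitEq m n β τ = 0) : implicitEq m n β σ ≤ 0 := by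
  have := mul_implicitEq_le hnm hβ hσ hστ
  rw [h, mul_zero] at this
  exact nonpos_of_mul_nonpos_right this (hσ.trans_le hστ)

lemma implicitEq_nonneg (hnm : n < m) {β σ τ : ℝ} (hβ : 0 ≤ β) (hσ : 0 < σ) (hστ : σ ≤ τ)
    (h : implicitEq m n β σ = 0) : 0 ≤ implicitEq m n β τ := by
  have := mul_implicitEq_le hnm hβ hσ hστ
  rw [h, mul_zero] at this
  exact nonneg_of_mul_nonneg_right this hσ

lemma Kc_mul_rpow (hn : 0 < n) (hnm : n < m) {x : ℝ} (hx : 0 ≤ x) :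
    Kc m n * x ^ ((m : ℝ) / n) =
      ((m : ℝ) / ((m : ℝ) - n) - 1) * (x / ((m : ℝ) / ((m : ℝ) - n))) ^ ((m : ℝ) / n) := by
  have hn' : (0 : ℝ) < n := by exact_mod_cast hn
  have hnm' : (0 : ℝ) < (m : ℝ) - n := by rw [sub_pos]; exact_mod_cast hnm
  have hm' : (0 : ℝ) < m := by linarith
  have h1 : x / ((m : ℝ) / ((m : ℝ) - n)) = ((m : ℝ) - n) / m * x := by field_simp
  have h2 : (m : ℝ) / ((m : ℝ) - n) - 1 = n / ((m : ℝ) - n) := by field_simp; ring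
  rw [Kc, h1, h2, Real.mul_rpow (by positivity) hx, mul_assoc]

lemma implicitEq_at_endpoint (hn : 0 < n) (hnm : n < m) (σ : ℝ) :
    implicitEq m n ((m : ℝ) / ((m : ℝ) - n)) σ = 2 * m * σ - (m : ℝ) / ((m : ℝ) - n) *
      (n + m * σ - ((m : ℝ) - n) * σ ^ ((m : ℝ) / ((m : ℝ) - n))) := by
  have hnm' : (0 : ℝ) < (m : ℝ) - n := by rw [sub_pos]; exact_mod_cast hnm
  have hm' : (0 : ℝ) < m := by exact_mod_cast hn.trans hnm
  have hp : (0 : ℝ) < (m : ℝ) / ((m : ℝ) - n) := by positivity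
  have hK := Kc_mul_rpow hn hnm hp.le
  rw [div_self hp.ne', Real.one_rpow, mul_one] at hK
  unfold implicitEq
  set p := (m : ℝ) / ((m : ℝ) - n)
  linear_combination -(m : ℝ) * σ * hK

end ImplicitFunction

section PositiveCoefficients

variable {m n : ℕ} {a b d : ℝ}

lemma left_critical_value (hn : 0 < n) (hnm : n < m) (ha : 0 < a) (hb : 0 < b) :
    Kc m n * a * (b / a) ^ ((m : ℝ) / n) =
      ((m : ℝ) / ((m : ℝ) - n) - 1) * a *
        (b / ((m : ℝ) / ((m : ℝ) - n) * a)) ^ ((m : ℝ) / n) := by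
  have h := Kc_mul_rpow hn hnm (div_pos hb ha).le
  rw [div_div, mul_comm a] at h
  linear_combination a * h

lemma right_critical_value (hn : 0 < n) (hnm : n < m) (hb : 0 < b) (hd : 0 < d) :
    Kc m (m - n) * d * (b / d) ^ ((m : ℝ) / ((m : ℝ) - n)) =
      ((m : ℝ) / n - 1) * d * (b / ((m : ℝ) / n * d)) ^ ((m : ℝ) / ((m : ℝ) - n)) := by
  have h := left_critical_value (m := m) (n := m - n) (by omega) (by omega) hd hb
  rwa [Nat.cast_sub hnm.le, sub_sub_cancel] at h

lemma ratio_mul_sub_critical_values (hn : 0 < n) (hnm : n < m) (ha : 0 < a) (hb : 0 < b)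
    (hd : 0 < d) :
    m * (n * b / (m * d)) * (b / a) *
      ((a + ((m : ℝ) / n - 1) * d * (b / ((m : ℝ) / n * d)) ^ ((m : ℝ) / ((m : ℝ) - n))) -
        (d + ((m : ℝ) / ((m : ℝ) - n) - 1) * a *
          (b / ((m : ℝ) / ((m : ℝ) - n) * a)) ^ ((m : ℝ) / n))) =
      b * implicitEq m n (b / a) (n * b / (m * d)) := by
  have hn' : (0 : ℝ) < n := by exact_mod_cast hn
  have hm' : (0 : ℝ) < m := by exact_mod_cast hn.trans hnm
  have hσ : b / ((m : ℝ) / n * d) = n * b / (m * d) := by field_simp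
  rw [← left_critical_value hn hnm ha hb, hσ, implicitEq]
  generalize (n * b / (m * d)) ^ ((m : ℝ) / ((m : ℝ) - n)) = x
  generalize (b / a) ^ ((m : ℝ) / n) = y
  field_simp
  ring

lemma ratio_mul_sub_endpoint_value (hn : 0 < n) (hnm : n < m) (ha : 0 < a) (hd : 0 < d) :
    m * (n * b / (m * d)) * (b / a) *
      ((a + ((m : ℝ) / n - 1) * d * (b / ((m : ℝ) / n * d)) ^ ((m : ℝ) / ((m : ℝ) - n))) -
        (d - a + b)) =
      b * (2 * m * (n * b / (m * d)) - b / a * (n + m * (n * b / (m * d)) -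
        ((m : ℝ) - n) * (n * b / (m * d)) ^ ((m : ℝ) / ((m : ℝ) - n)))) := by
  have hn' : (0 : ℝ) < n := by exact_mod_cast hn
  have hm' : (0 : ℝ) < m := by exact_mod_cast hn.trans hnm
  have hσ : b / ((m : ℝ) / n * d) = n * b / (m * d) := by field_simp
  rw [hσ]
  generalize (n * b / (m * d)) ^ ((m : ℝ) / ((m : ℝ) - n)) = x
  field_simp
  ring

lemma endpoint_denominator_pos (hn : 0 < n) (hnm : n < m) {σ : ℝ} (hσ0 : 0 ≤ σ) (hσ1 : σ ≤ 1) :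
    0 < n + m * σ - ((m : ℝ) - n) * σ ^ ((m : ℝ) / ((m : ℝ) - n)) := by
  have hn' : (0 : ℝ) < n := by exact_mod_cast hn
  have hnm' : (0 : ℝ) < (m : ℝ) - n := by rw [sub_pos]; exact_mod_cast hnm
  have h : σ ^ ((m : ℝ) / ((m : ℝ) - n)) ≤ σ := by
    apply Real.rpow_le_self_of_le_one hσ0 hσ1
    rw [one_le_div hnm']
    linarith
  nlinarith [mul_nonneg hn'.le hσ0]

/-- When the critical point `b / (q d)` lies beyond `1`, the corner dominates. -/
lemma left_critical_le_corner {p q : ℝ} (hpq : p.HolderConjugate q) (hq : 2 ≤ q) (ha : 0 < a)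
    (hb : 0 < b) (hab : b ≤ p * a) (hdb : q * d < b) :
    d + (p - 1) * a * (b / (p * a)) ^ q ≤ |a - d| + b := by
  have hp0 := hpq.pos
  have hq0 := hpq.symm.pos
  have hu0 : 0 ≤ b / (p * a) := by positivity
  have hu : (b / (p * a)) ^ q ≤ b / (p * a) :=
    Real.rpow_le_self_of_le_one hu0 ((div_le_one (by positivity)).2 hab) (by linarith)
  have h1 : (p - 1) * a * (b / (p * a)) ^ q ≤ b / q := by
    calc (p - 1) * a * (b / (p * a)) ^ q ≤ (p - 1) * a * (b / (p * a)) :=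
          mul_le_mul_of_nonneg_left hu (mul_nonneg hpq.sub_one_pos.le ha.le)
      _ = b / q := by rw [← hpq.div_conj_eq_sub_one]; field_simp
  have h2 : d + b / q ≤ b := by
    have : d < b / q := by rw [lt_div_iff₀ hq0]; linarith
    have : b / q ≤ b / 2 := by gcongr
    linarith
  linarith [abs_nonneg (a - d)]

/-- The three formulas for coefficients of signs `+, +, -`. -/
lemma homNorm_of_pos_pos_neg (hm : Even m) (hn : Odd n) (h2n : 2 * n ≤ m) {Λ : ℝ → ℝ}
    (hanti : StrictAntiOn Λ (Icc (0 : ℝ) ((m : ℝ) / ((m : ℝ) - n)))) (h0 : Λ 0 = 0)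
    (hrange : ∀ b ∈ Icc (0 : ℝ) ((m : ℝ) / ((m : ℝ) - n)), Λ b ∈ Icc (-1 : ℝ) 0)
    (heq : ∀ b ∈ Icc (0 : ℝ) ((m : ℝ) / ((m : ℝ) - n)),
      (m : ℝ) * Kc m n * Λ b * b ^ ((m : ℝ) / n) - n * b - m * Λ b +
        ((m : ℝ) - n) * b * |Λ b| ^ ((m : ℝ) / ((m : ℝ) - n)) = 0)
    (ha : 0 < a) (hb : 0 < b) (hd : 0 < d) :
    ((b / a, -(n * b / (m * d))) ∈ Aone m n Λ →
      homNorm m n a b (-d) = Kc m n * a * (b / a) ^ ((m : ℝ) / n) + d) ∧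
    ((b / a, -(n * b / (m * d))) ∈ Bone m n Λ →
      homNorm m n a b (-d) = Kc m (m - n) * d * (b / d) ^ ((m : ℝ) / ((m : ℝ) - n)) + a) ∧
    ((b / a, -(n * b / (m * d))) ∉ Aone m n Λ → (b / a, -(n * b / (m * d))) ∉ Bone m n Λ →
      homNorm m n a b (-d) = |a - d| + b) := by
  have hnm : n < m := by have := hn.pos; omega
  have hn' : (0 : ℝ) < n := by exact_mod_cast hn.pos
  have hnm' : (0 : ℝ) < (m : ℝ) - n := by rw [sub_pos]; exact_mod_cast hnm
  have hm' : (0 : ℝ) < m := by linarith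
  have hpq := holderConjugate_degree_div hn.pos hnm
  have hq2 : 2 ≤ (m : ℝ) / n := by rw [le_div_iff₀ hn']; exact_mod_cast h2n
  have hdiff := ratio_mul_sub_critical_values hn.pos hnm ha hb hd
  have hend := ratio_mul_sub_endpoint_value (b := b) hn.pos hnm ha hd
  have y2 := mul_le_rpow_add_conj hpq.symm hd hb zero_le_one
  rw [left_critical_value hn.pos hnm ha hb, right_critical_value hn.pos hnm hb hd]
  have hleft := homNorm_eq_left_critical hm hn hnm ha hb hd rfl rfl
  have hright := homNorm_eq_right_critical hm hn hnm ha hb hd rfl rfl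
  have hcorner := homNorm_eq_corner hm hn hnm ha hb hd rfl rfl
  have hβp : b ≤ (m : ℝ) / ((m : ℝ) - n) * a ↔ b / a ≤ (m : ℝ) / ((m : ℝ) - n) :=
    (div_le_iff₀ ha).symm
  have hσ1 : b ≤ (m : ℝ) / n * d ↔ n * b / (m * d) ≤ 1 := by
    rw [div_le_one (by positivity), div_mul_eq_mul_div, le_div_iff₀ hn', mul_comm b]
  have hpoint := implicitEq_at_endpoint hn.pos hnm (n * b / (m * d))
  have hcritle := left_critical_le_corner hpq hq2 (d := d) ha hb
  rw [Real.one_rpow] at y2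
  have hβ : 0 < b / a := by positivity
  have hσ : 0 < n * b / (m * d) := by positivity
  have hp0 : 0 < (m : ℝ) / ((m : ℝ) - n) := by positivity
  have hD := endpoint_denominator_pos hn.pos hnm hσ.le
  have hg : gfun m n (-(n * b / (m * d))) = 2 * m * (n * b / (m * d)) /
      (n + m * (n * b / (m * d)) -
        ((m : ℝ) - n) * (n * b / (m * d)) ^ ((m : ℝ) / ((m : ℝ) - n))) := by
    rw [gfun, abs_neg, abs_of_pos hσ, ← neg_div_neg_eq]
    congr 1 <;> ring
  have hzero (x : ℝ) (hx : 0 < x) (hxp : x ≤ (m : ℝ) / ((m : ℝ) - n)) :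
      0 < -Λ x ∧ implicitEq m n x (-Λ x) = 0 := by
    have hneg : Λ x < 0 := h0 ▸ hanti ⟨le_rfl, hp0.le⟩ ⟨hx.le, hxp⟩ hx
    refine ⟨neg_pos.2 hneg, ?_⟩
    have := heq x ⟨hx.le, hxp⟩
    rw [abs_of_neg hneg] at this
    rw [implicitEq]
    linear_combination this
  have hτ1 : -Λ ((m : ℝ) / ((m : ℝ) - n)) ≤ 1 := by
    linarith [(hrange _ ⟨hp0.le, le_rfl⟩).1]
  have hmono (x : ℝ) (hx : 0 < x) (hxp : x ≤ (m : ℝ) / ((m : ℝ) - n)) :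
      -Λ x ≤ -Λ ((m : ℝ) / ((m : ℝ) - n)) :=
    neg_le_neg (hanti.antitoneOn ⟨hx.le, hxp⟩ ⟨hp0.le, le_rfl⟩ hxp)
  simp only [Aone, Bone, mem_union, mem_ofPred_eq, hg, hβ, true_and]
  set β := b / a
  set σ := n * b / (m * d)
  set p := (m : ℝ) / ((m : ℝ) - n)
  set q := (m : ℝ) / n
  set L := (p - 1) * a * (b / (p * a)) ^ q
  set R := (q - 1) * d * (b / (q * d)) ^ p
  set D := n + m * σ - ((m : ℝ) - n) * σ ^ p
  have hw : 0 < m * σ * β := by positivity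
  have hLR : 0 ≤ implicitEq m n β σ → d + L ≤ a + R := fun h => by
    have := nonneg_of_mul_nonneg_right (hdiff.ge.trans' (mul_nonneg hb.le h)) hw
    linarith
  have hRL : implicitEq m n β σ ≤ 0 → a + R ≤ d + L := fun h => by
    have := nonpos_of_mul_nonpos_right
      (hdiff.le.trans (mul_nonpos_of_nonneg_of_nonpos hb.le h)) hw
    linarith
  have hER : β * D ≤ 2 * m * σ → d - a + b ≤ a + R := fun h => by
    have := nonneg_of_mul_nonneg_right
      (hend.ge.trans' (mul_nonneg hb.le (sub_nonneg.2 h))) hw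
    linarith
  have hRE : 2 * m * σ ≤ β * D → a + R ≤ d - a + b := fun h => by
    have := nonpos_of_mul_nonpos_right
      (hend.le.trans (mul_nonpos_of_nonneg_of_nonpos hb.le (sub_nonpos.2 h))) hw
    linarith
  have hlow (x : ℝ) (hx : 0 < x) (hxp : x ≤ p) (h : σ ≤ -Λ x) : implicitEq m n x σ ≤ 0 :=
    implicitEq_nonpos hnm hx.le hσ h (hzero x hx hxp).2
  have hhigh (x : ℝ) (hx : 0 < x) (hxp : x ≤ p) (h : -Λ x ≤ σ) : 0 ≤ implicitEq m n x σ :=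
    implicitEq_nonneg hnm hx.le (hzero x hx hxp).1 h (hzero x hx hxp).2
  have habs1 := le_abs_self (a - d)
  have habs2 := neg_abs_le (a - d)
  have y1 := mul_le_rpow_add_conj hpq ha hb zero_le_one
  rw [Real.one_rpow] at y1
  refine ⟨?_, ?_, ?_⟩
  · rintro ⟨hβ1, hΛ, -⟩
    rw [hleft (hβp.2 hβ1) (hRL (hlow β hβ hβ1 (by linarith))), add_comm]
  · intro h
    rw [add_comm]
    rcases le_or_gt β p with hβ1 | hβ1
    · have hlam : -Λ β ≤ σ ∧ σ ≤ 1 := by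
        have := hmono β hβ hβ1
        rcases h with ⟨-, h1, h2⟩ | ⟨h1, h2, -⟩ <;> constructor <;> linarith
      have hle := hLR (hhigh β hβ hβ1 hlam.1)
      exact hright (hσ1.2 hlam.2) (by linarith) (Or.inl hle)
    · rcases h with ⟨h, -⟩ | ⟨h1, h2, h3⟩
      · exact absurd h hβ1.not_ge
      · have h1' : σ ≤ 1 := by linarith
        rw [le_div_iff₀ (hD h1')] at h3
        exact hright (hσ1.2 h1') (hER h3) (Or.inr (not_le.1 (mt hβp.1 hβ1.not_ge)))
  · intro hA hB
    rw [not_or] at hB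
    obtain ⟨hB1, hB2⟩ := hB
    rcases le_or_gt σ 1 with h1 | h1
    · have hDpos := hD h1
      rw [le_div_iff₀ hDpos] at hB2
      rcases le_or_gt β p with hβ1 | hβ1
      · exfalso
        have hσΛ : -Λ β < σ := by
          by_contra! h
          exact hA ⟨hβ1, by linarith, by linarith⟩
        have hστ : -Λ p < σ := by
          by_contra! h
          exact hB1 ⟨hβ1, by linarith, by linarith⟩
        have := hhigh p hp0 le_rfl hστ.le
        rw [hpoint] at this
        exact hB2 ⟨by linarith, by linarith,
          (mul_le_mul_of_nonneg_right hβ1 hDpos.le).trans (by linarith)⟩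
      · refine hcorner (Or.inr (not_le.1 (mt hβp.1 hβ1.not_ge))) (Or.inl ?_)
        have : 2 * m * σ ≤ β * D := by
          rcases le_or_gt σ (-Λ p) with h2 | h2
          · have := hlow p hp0 le_rfl h2
            rw [hpoint] at this
            exact (sub_nonpos.1 this).trans (mul_le_mul_of_nonneg_right hβ1.le hDpos.le)
          · by_contra! h3
            exact hB2 ⟨by linarith, by linarith, h3.le⟩
        linarith [hRE this]
    · have hdb : q * d < b := not_le.1 (mt hσ1.1 h1.not_ge)
      refine hcorner ?_ (Or.inr hdb)
      rcases le_or_gt b (p * a) with h2 | h2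
      · exact Or.inl (hcritle h2 hdb)
      · exact Or.inr h2

end PositiveCoefficients

section Signs

variable {m n : ℕ}

lemma homNorm_of_mul_nonneg (hm : Even m) (hn : Odd n) (hnm : n < m) {a b c : ℝ}
    (hac : 0 ≤ a * c) : homNorm m n a b c = |a + c| + |b| := by
  have hsum : |a + c| = |a| + |c| := by
    rw [abs_add_eq_add_abs_iff]
    rcases mul_nonneg_iff.1 hac with h | h
    · exact Or.inl h
    · exact Or.inr h
  have hpq := holderConjugate_degree_div hn.pos hnm
  have hpow {e t : ℝ} (he : 0 ≤ e) (u : ℝ) (ht : |t| ≤ 1) : |u * |t| ^ e| ≤ |u| := by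
    rw [abs_mul, abs_of_nonneg (Real.rpow_nonneg (abs_nonneg t) e)]
    exact mul_le_of_le_one_right (abs_nonneg u) (Real.rpow_le_one (abs_nonneg t) ht he)
  have hlin {t : ℝ} (ht : |t| ≤ 1) : |b * t| ≤ |b| := by
    rw [abs_mul]
    exact mul_le_of_le_one_right (abs_nonneg b) ht
  refine homNorm_eq_of_bounds hm hn hnm ?_ ?_ (Or.inl ?_)
  · intro s hs
    linarith [abs_add_three (a * |s| ^ ((m : ℝ) / ((m : ℝ) - n))) (b * s) c,
      hpow hpq.nonneg a hs, hlin hs]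
  · intro t ht
    linarith [abs_add_three a (b * t) (c * |t| ^ ((m : ℝ) / n)),
      hpow hpq.symm.nonneg c ht, hlin ht]
  · rcases le_total 0 ((a + c) * b) with h | h
    · refine ⟨1, by simp, ?_⟩
      rw [abs_one, Real.one_rpow, ← (abs_add_eq_add_abs_iff _ _).2 (mul_nonneg_iff.1 h)]
      congr 1
      ring
    · refine ⟨-1, by simp, ?_⟩
      have h' : 0 ≤ (a + c) * -b := by linarith
      rw [abs_neg, abs_one, Real.one_rpow, ← abs_neg b,
        ← (abs_add_eq_add_abs_iff _ _).2 (mul_nonneg_iff.1 h')]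
      congr 1
      ring

lemma homNorm_zero_middle (hm : Even m) (hn : Odd n) (hnm : n < m) {a c : ℝ}
    (hac : a * c ≤ 0) : homNorm m n a 0 c = max |a| |c| := by
  have hpq := holderConjugate_degree_div hn.pos hnm
  have hconv {u v r : ℝ} (huv : u * v ≤ 0) (h0 : 0 ≤ r) (h1 : r ≤ 1) :
      |u * r + v| ≤ max |u| |v| := by
    have hu := le_max_left |u| |v|
    have hv := le_max_right |u| |v|
    rw [abs_le] at hu hv ⊢
    rcases mul_nonpos_iff.1 huv with h | h <;> constructor <;> nlinarith
  have hpow {e t : ℝ} (he : 0 ≤ e) (ht : |t| ≤ 1) : |t| ^ e ≤ 1 :=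
    Real.rpow_le_one (abs_nonneg t) ht he
  refine homNorm_eq_of_bounds hm hn hnm ?_ ?_ ?_
  · intro s hs
    simpa using hconv hac (Real.rpow_nonneg (abs_nonneg s) _) (hpow hpq.nonneg hs)
  · intro t ht
    have := hconv (mul_comm a c ▸ hac) (Real.rpow_nonneg (abs_nonneg t) _)
      (hpow hpq.symm.nonneg ht)
    rw [max_comm] at this
    simpa [add_comm] using this
  · rcases le_total |a| |c| with h | h
    · exact Or.inl ⟨0, by simp, by simp [Real.zero_rpow hpq.ne_zero, h]⟩
    · exact Or.inr ⟨0, by simp, by simp [Real.zero_rpow hpq.symm.ne_zero, h]⟩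

lemma neg_mem_Afull_iff {Λ : ℝ → ℝ} {p : ℝ × ℝ} : -p ∈ Afull m n Λ ↔ p ∈ Afull m n Λ := by
  simp [Afull, or_comm]

lemma neg_mem_Bfull_iff {Λ : ℝ → ℝ} {p : ℝ × ℝ} : -p ∈ Bfull m n Λ ↔ p ∈ Bfull m n Λ := by
  simp only [Bfull, mem_union, mem_ofPred_eq, neg_neg]
  exact or_comm

lemma mem_Afull_iff_of_pos {Λ : ℝ → ℝ} {p : ℝ × ℝ} (hp : 0 < p.1) :
    p ∈ Afull m n Λ ↔ p ∈ Aone m n Λ := by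
  refine or_iff_left fun h => ?_
  have : 0 < -p.1 := h.1
  linarith

lemma mem_Bfull_iff_of_pos {Λ : ℝ → ℝ} {p : ℝ × ℝ} (hp : 0 < p.1) :
    p ∈ Bfull m n Λ ↔ p ∈ Bone m n Λ := by
  refine or_iff_left fun h => ?_
  have : 0 < -p.1 := h.elim (fun h => h.1) (fun h => h.2.2.1)
  linarith

/-- The case distinction for nonzero coefficients. -/
def HasTrinomialFormulas (m n : ℕ) (Λ : ℝ → ℝ) (a b c : ℝ) : Prop :=
  ((b / a, (n : ℝ) * b / (m * c)) ∈ Afull m n Λ →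
    homNorm m n a b c = |Kc m n * a * |b / a| ^ ((m : ℝ) / n) - c|) ∧
  ((b / a, (n : ℝ) * b / (m * c)) ∈ Bfull m n Λ →
    homNorm m n a b c = |Kc m (m - n) * c * |b / c| ^ ((m : ℝ) / ((m : ℝ) - n)) - a|) ∧
  ((b / a, (n : ℝ) * b / (m * c)) ∉ Afull m n Λ ∪ Bfull m n Λ →
    homNorm m n a b c = |a + c| + |b|)

lemma HasTrinomialFormulas.of_neg {Λ : ℝ → ℝ} {a b c : ℝ}
    (h : HasTrinomialFormulas m n Λ (-a) (-b) (-c)) : HasTrinomialFormulas m n Λ a b c := by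
  unfold HasTrinomialFormulas at h
  rw [homNorm_neg, neg_div_neg_eq, neg_div_neg_eq, mul_neg, mul_neg, mul_neg, mul_neg,
    neg_div_neg_eq, neg_mul, neg_mul, neg_sub_neg, neg_sub_neg, abs_sub_comm c, abs_sub_comm a,
    ← neg_add, abs_neg (a + c), abs_neg b] at h
  exact h

lemma HasTrinomialFormulas.of_neg_middle (hm : Even m) (hn : Odd n) {Λ : ℝ → ℝ} {a b c : ℝ}
    (h : HasTrinomialFormulas m n Λ a (-b) c) : HasTrinomialFormulas m n Λ a b c := by
  have hpair : ((-b) / a, (n : ℝ) * (-b) / (m * c)) = -(b / a, (n : ℝ) * b / (m * c)) := by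
    simp [neg_div]
  unfold HasTrinomialFormulas at h
  rw [homNorm_neg_middle hm hn, hpair, mem_union, neg_mem_Afull_iff, neg_mem_Bfull_iff, neg_div,
    neg_div, abs_neg, abs_neg, abs_neg] at h
  exact h

end Signs

theorem stmt12 (m n : ℕ) (hm : Even m) (hn : Odd n) (h2n : 2 * n ≤ m)
    (Λ : ℝ → ℝ)
    (hcont : ContinuousOn Λ (Icc (0 : ℝ) ((m : ℝ) / ((m : ℝ) - n))))
    (hanti : StrictAntiOn Λ (Icc (0 : ℝ) ((m : ℝ) / ((m : ℝ) - n))))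
    (h0 : Λ 0 = 0)
    (hrange : ∀ b ∈ Icc (0 : ℝ) ((m : ℝ) / ((m : ℝ) - n)), Λ b ∈ Icc (-1 : ℝ) 0)
    (heq : ∀ b ∈ Icc (0 : ℝ) ((m : ℝ) / ((m : ℝ) - n)),
      (m : ℝ) * Kc m n * Λ b * b ^ ((m : ℝ) / n) - n * b - m * Λ b +
        ((m : ℝ) - n) * b * |Λ b| ^ ((m : ℝ) / ((m : ℝ) - n)) = 0) :
    ∀ a b c : ℝ,
      (a * b * c ≠ 0 → (b / a, (n : ℝ) * b / (m * c)) ∈ Afull m n Λ →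
        homNorm m n a b c = |Kc m n * a * |b / a| ^ ((m : ℝ) / n) - c|) ∧
      (a * b * c ≠ 0 → (b / a, (n : ℝ) * b / (m * c)) ∈ Bfull m n Λ →
        homNorm m n a b c = |Kc m (m - n) * c * |b / c| ^ ((m : ℝ) / ((m : ℝ) - n)) - a|) ∧
      (b = 0 → a * c ≤ 0 → homNorm m n a b c = max |a| |c|) ∧
      (¬ (a * b * c ≠ 0 ∧ (b / a, (n : ℝ) * b / (m * c)) ∈ Afull m n Λ ∪ Bfull m n Λ) →
        ¬ (b = 0 ∧ a * c ≤ 0) →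
        homNorm m n a b c = |a + c| + |b|) := by
  have hnm : n < m := by have := hn.pos; omega
  have hnm' : (0 : ℝ) < (m : ℝ) - n := by rw [sub_pos]; exact_mod_cast hnm
  have hn' : (0 : ℝ) < n := by exact_mod_cast hn.pos
  have hm' : (0 : ℝ) < m := by linarith
  have hppn {a b c : ℝ} (ha : 0 < a) (hb : 0 < b) (hc : c < 0) :
      HasTrinomialFormulas m n Λ a b c := by
    obtain ⟨d, rfl⟩ : ∃ d, c = -d := ⟨-c, (neg_neg c).symm⟩
    have hd : 0 < d := neg_neg_iff_pos.1 hc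
    have h := homNorm_of_pos_pos_neg hm hn h2n hanti h0 hrange heq ha hb hd
    have hβ : 0 < b / a := by positivity
    have hK : 0 ≤ Kc m n * a * (b / a) ^ ((m : ℝ) / n) := by unfold Kc; positivity
    have hK' : 0 ≤ Kc m (m - n) * d * (b / d) ^ ((m : ℝ) / ((m : ℝ) - n)) := by
      rw [Kc, Nat.cast_sub hnm.le, sub_sub_cancel]; positivity
    unfold HasTrinomialFormulas
    rw [mem_union, mem_Afull_iff_of_pos hβ, mem_Bfull_iff_of_pos hβ, not_or, mul_neg, div_neg,
      div_neg, abs_neg, abs_of_pos hβ, abs_of_pos (div_pos hb hd), abs_of_pos hb, mul_neg, neg_mul,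
      sub_neg_eq_add, abs_of_nonneg (by linarith), ← neg_add', abs_neg,
      abs_of_nonneg (by linarith), ← sub_eq_add_neg, and_imp]
    exact h
  have hpn {a b c : ℝ} (ha : 0 < a) (hb : b ≠ 0) (hc : c < 0) :
      HasTrinomialFormulas m n Λ a b c := by
    rcases hb.lt_or_gt with hb | hb
    · exact (hppn ha (neg_pos.2 hb) hc).of_neg_middle hm hn
    · exact hppn ha hb hc
  have hopp {a b c : ℝ} (hb : b ≠ 0) (hac : a * c < 0) : HasTrinomialFormulas m n Λ a b c := by
    rcases mul_neg_iff.1 hac with ⟨ha, hc⟩ | ⟨ha, hc⟩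
    · exact hpn ha hb hc
    · exact (hpn (neg_pos.2 ha) (neg_ne_zero.2 hb) (neg_neg_iff_pos.2 hc)).of_neg
  have hΛneg {x : ℝ} (hx : 0 < x) (hxp : x ≤ (m : ℝ) / ((m : ℝ) - n)) : Λ x < 0 :=
    h0 ▸ hanti ⟨le_rfl, by positivity⟩ ⟨hx.le, hxp⟩ hx
  have hBsign {x : ℝ × ℝ} (hx : x ∈ Bone m n Λ) : x.1 * x.2 < 0 := by
    rcases hx with ⟨h1, h2, -, h3⟩ | ⟨-, h1, h2, -⟩
    · exact mul_neg_of_pos_of_neg h1 (h3.trans_lt (hΛneg h1 h2))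
    · exact mul_neg_of_pos_of_neg h2 (h1.trans_lt (hΛneg (by positivity) le_rfl))
  have hsign {a b c : ℝ} (h : (b / a, (n : ℝ) * b / (m * c)) ∈ Afull m n Λ ∪ Bfull m n Λ) :
      a * c < 0 := by
    have hlt : b / a * ((n : ℝ) * b / (m * c)) < 0 := by
      rcases h with (h | h) | (h | h)
      · exact mul_neg_of_pos_of_neg h.1 h.2.2.2
      · exact neg_mul_neg (b / a) _ ▸ mul_neg_of_pos_of_neg h.1 h.2.2.2
      · exact hBsign h
      · exact neg_mul_neg (b / a) _ ▸ hBsign h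
    by_contra! hac
    have : b / a * ((n : ℝ) * b / (m * c)) = n * b ^ 2 / (m * (a * c)) := by
      rw [div_mul_div_comm]; congr 1 <;> ring
    rw [this] at hlt
    exact hlt.not_ge (by positivity)
  intro a b c
  refine ⟨fun habc h => ?_, fun habc h => ?_, fun hb hac => ?_, fun h h' => ?_⟩
  · exact (hopp (right_ne_zero_of_mul (left_ne_zero_of_mul habc)) (hsign (Or.inl h))).1 h
  · exact (hopp (right_ne_zero_of_mul (left_ne_zero_of_mul habc)) (hsign (Or.inr h))).2.1 h
  · subst hb
    exact homNorm_zero_middle hm hn hnm hac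
  · rcases le_or_gt 0 (a * c) with hac | hac
    · exact homNorm_of_mul_nonneg hm hn hnm hac
    · have hb : b ≠ 0 := fun hb => h' ⟨hb, hac.le⟩
      refine (hopp hb hac).2.2 fun hmem => h ⟨?_, hmem⟩
      rw [mul_right_comm]
      exact mul_ne_zero hac.ne hb
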